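/- Let G and H be countable discrete groups, let F be a finite group together with injective homomorphisms F ↪ G and F ↪ H, and let p > 1 with p ∉ 2ℤ ∖ {2}. Then G and H both have property PL^p if and only if the amalgamated free product G *_F H has property PL^p. -/

import Mathlib

open MeasureTheory

noncomputable section

/-- A countable discrete group has property `PL^p`: it admits a proper isometric affine
action (linear part `π`, cocycle `b`) on some `L^p` space, properness meaning that
`{g : ‖b g‖ ≤ R}` is finite for every `R`. -/
def HasPLpDiscrete (G : Type*) [Group G] (p : ℝ) : Prop :=
  ∃ (Ω : Type) (_ : MeasurableSpace Ω) (μ : Measure Ω)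
    (_ : Fact (1 ≤ ENNReal.ofReal p))
    (π : G →* ((Lp ℝ (ENNReal.ofReal p) μ) ≃ₗᵢ[ℝ] (Lp ℝ (ENNReal.ofReal p) μ)))
    (b : G → Lp ℝ (ENNReal.ofReal p) μ),
    (∀ g h : G, b (g * h) = π g (b h) + b g) ∧
    (∀ R : ℝ, {g : G | ‖b g‖ ≤ R}.Finite)

section AmalgamatedProduct

variable (G H F : Type) [Group G] [Group H] [Group F]

/-- The pair of factors of the amalgamated free product, indexed by `Bool`. -/
def amalgFactor : Bool → Type := fun b => cond b G H

instance amalgFactorGroup : ∀ b : Bool, Group (amalgFactor G H b)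
  | true => ‹Group G›
  | false => ‹Group H›

variable {G H F}

/-- The family of inclusions of the common subgroup `F` into the two factors. -/
def amalgMaps (φG : F →* G) (φH : F →* H) : ∀ b : Bool, F →* amalgFactor G H b
  | true => φG
  | false => φH

/-- The amalgamated free product `G *_F H`, as the pushout of `F → G` and `F → H`. -/
abbrev AmalgamatedFreeProduct (φG : F →* G) (φH : F →* H) : Type :=
  Monoid.PushoutI (amalgMaps φG φH)

end AmalgamatedProduct

section SigmaMeasure

open scoped ENNReal

variable {Z : Type} {Ω : Z → Type} [∀ z, MeasurableSpace (Ω z)]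

theorem measurable_sigmaMk (z : Z) : Measurable (Sigma.mk z : Ω z → Σ z, Ω z) :=
  fun _ hs => MeasurableSpace.measurableSet_iInf.1 hs z

theorem measurable_of_forall_sigmaMk {β : Type*} [MeasurableSpace β] {f : (Σ z, Ω z) → β}
    (hf : ∀ z, Measurable fun x => f ⟨z, x⟩) : Measurable f :=
  fun _ hs => MeasurableSpace.measurableSet_iInf.2 fun z => hf z hs

/-- The disjoint union of a family of measures. -/
def sigmaMeasure (μ : ∀ z, Measure (Ω z)) : Measure (Σ z, Ω z) :=
  Measure.sum fun z => (μ z).map (Sigma.mk z)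

variable {μ : ∀ z, Measure (Ω z)} {q : ℝ≥0∞}

theorem ae_of_ae_sigmaMeasure {P : (Σ z, Ω z) → Prop} (h : ∀ᵐ x ∂sigmaMeasure μ, P x) (z : Z) :
    ∀ᵐ x ∂μ z, P ⟨z, x⟩ :=
  ae_of_ae_map (measurable_sigmaMk z).aemeasurable
    ((Measure.absolutelyContinuous_of_le (Measure.le_sum _ z)).ae_le h)

theorem lintegral_sigmaMeasure {f : (Σ z, Ω z) → ℝ≥0∞} (hf : Measurable f) :
    ∫⁻ x, f x ∂sigmaMeasure μ = ∑' z, ∫⁻ x, f ⟨z, x⟩ ∂μ z := by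
  rw [sigmaMeasure, lintegral_sum_measure]
  exact tsum_congr fun z => lintegral_map hf (measurable_sigmaMk z)

theorem eLpNorm_sigmaMeasure_rpow (hq0 : q ≠ 0) (hq : q ≠ ∞) {f : (Σ z, Ω z) → ℝ}
    (hf : Measurable f) :
    eLpNorm f q (sigmaMeasure μ) ^ q.toReal
      = ∑' z, eLpNorm (fun x => f ⟨z, x⟩) q (μ z) ^ q.toReal := by
  have hpos : q.toReal ≠ 0 := (ENNReal.toReal_pos hq0 hq).ne'
  simp_rw [eLpNorm_eq_lintegral_rpow_enorm_toReal hq0 hq, one_div, ENNReal.rpow_inv_rpow hpos]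
  exact lintegral_sigmaMeasure (hf.enorm.pow_const _)

variable [Fact (1 ≤ q)]

theorem memLp_sigmaMk (hq : q ≠ ∞) (f : Lp ℝ q (sigmaMeasure μ)) (z : Z) :
    MemLp (fun x => f ⟨z, x⟩) q (μ z) := by
  have hq0 : q ≠ 0 := (zero_lt_one.trans_le Fact.out).ne'
  have hpos : 0 < q.toReal := ENNReal.toReal_pos hq0 hq
  have hf := (Lp.stronglyMeasurable f).measurable
  refine ⟨(hf.comp (measurable_sigmaMk z)).aestronglyMeasurable, ?_⟩
  rw [← ENNReal.rpow_lt_top_iff_of_pos hpos]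
  refine (ENNReal.le_tsum (f := fun z => eLpNorm (fun x => f ⟨z, x⟩) q (μ z) ^ q.toReal)
    z).trans_lt ?_
  rw [← eLpNorm_sigmaMeasure_rpow hq0 hq hf]
  exact ENNReal.rpow_lt_top_of_nonneg hpos.le (Lp.memLp f).eLpNorm_ne_top

theorem ofReal_norm_rpow {Ω : Type*} [MeasurableSpace Ω] {μ : Measure Ω} (f : Lp ℝ q μ) :
    ENNReal.ofReal (‖f‖ ^ q.toReal) = eLpNorm f q μ ^ q.toReal := by
  rw [← ENNReal.ofReal_rpow_of_nonneg (norm_nonneg _) ENNReal.toReal_nonneg, ofReal_norm,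
    Lp.enorm_def]

theorem tsum_ofReal_norm_rpow_sigmaMk (hq : q ≠ ∞) (f : Lp ℝ q (sigmaMeasure μ)) :
    ∑' z, ENNReal.ofReal (‖(memLp_sigmaMk hq f z).toLp‖ ^ q.toReal)
      = ENNReal.ofReal (‖f‖ ^ q.toReal) := by
  have hq0 : q ≠ 0 := (zero_lt_one.trans_le Fact.out).ne'
  rw [ofReal_norm_rpow, eLpNorm_sigmaMeasure_rpow hq0 hq (Lp.stronglyMeasurable f).measurable]
  refine tsum_congr fun z => ?_
  rw [ofReal_norm_rpow, eLpNorm_congr_ae (MemLp.coeFn_toLp _)]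

theorem memℓp_sigmaMk (hq : q ≠ ∞) (f : Lp ℝ q (sigmaMeasure μ)) :
    Memℓp (fun z => (memLp_sigmaMk hq f z).toLp) q := by
  refine memℓp_gen ?_
  have h := tsum_ofReal_norm_rpow_sigmaMk hq f
  have := ENNReal.summable_toReal (h.trans_ne ENNReal.ofReal_ne_top)
  refine this.congr fun z => ?_
  rw [ENNReal.toReal_ofReal (by positivity)]

/-- Restricting to the pieces of a disjoint union. -/
def lpSigmaLinearMap (μ : ∀ z, Measure (Ω z)) (hq : q ≠ ∞) :
    Lp ℝ q (sigmaMeasure μ) →ₗ[ℝ] lp (fun z => Lp ℝ q (μ z)) q where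
  toFun f := ⟨fun z => (memLp_sigmaMk hq f z).toLp, memℓp_sigmaMk hq f⟩
  map_add' f g := by
    ext z : 2
    change (memLp_sigmaMk hq (f + g) z).toLp
      = (memLp_sigmaMk hq f z).toLp + (memLp_sigmaMk hq g z).toLp
    rw [← MemLp.toLp_add]
    refine (MemLp.toLp_eq_toLp_iff _ _).2 ?_
    exact ae_of_ae_sigmaMeasure (Lp.coeFn_add f g) z
  map_smul' c f := by
    ext z : 2
    change (memLp_sigmaMk hq (c • f) z).toLp = c • (memLp_sigmaMk hq f z).toLp
    rw [← MemLp.toLp_const_smul]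
    refine (MemLp.toLp_eq_toLp_iff _ _).2 ?_
    exact ae_of_ae_sigmaMeasure (Lp.coeFn_smul c f) z

theorem norm_lpSigmaLinearMap (hq : q ≠ ∞) (f : Lp ℝ q (sigmaMeasure μ)) :
    ‖lpSigmaLinearMap μ hq f‖ = ‖f‖ := by
  have hq0 : q ≠ 0 := (zero_lt_one.trans_le Fact.out).ne'
  have hpos : 0 < q.toReal := ENNReal.toReal_pos hq0 hq
  refine (Real.rpow_left_inj (norm_nonneg _) (norm_nonneg _) hpos.ne').1 ?_
  rw [lp.norm_rpow_eq_tsum hpos]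
  have h := congrArg ENNReal.toReal (tsum_ofReal_norm_rpow_sigmaMk hq f)
  rw [ENNReal.toReal_ofReal (by positivity), ENNReal.tsum_toReal_eq (by simp)] at h
  rw [← h]
  refine tsum_congr fun z => ?_
  rw [ENNReal.toReal_ofReal (by positivity)]
  rfl

theorem lpSigmaLinearMap_surjective (hq : q ≠ ∞) :
    Function.Surjective (lpSigmaLinearMap μ hq) := by
  intro g
  have hq0 : q ≠ 0 := (zero_lt_one.trans_le Fact.out).ne'
  have hpos : 0 < q.toReal := ENNReal.toReal_pos hq0 hq
  have hm : Measurable (fun x : Σ z, Ω z => (g x.1 : Ω x.1 → ℝ) x.2) :=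
    measurable_of_forall_sigmaMk fun z => (Lp.stronglyMeasurable (g z)).measurable
  have hmem : MemLp (fun x : Σ z, Ω z => (g x.1 : Ω x.1 → ℝ) x.2) q (sigmaMeasure μ) := by
    refine ⟨hm.aestronglyMeasurable, ?_⟩
    rw [← ENNReal.rpow_lt_top_iff_of_pos hpos, eLpNorm_sigmaMeasure_rpow hq0 hq hm]
    have h (z : Z) : eLpNorm (g z : Ω z → ℝ) q (μ z) ^ q.toReal
        = ENNReal.ofReal (‖g z‖ ^ q.toReal) := (ofReal_norm_rpow (g z)).symm
    rw [tsum_congr h, ← ENNReal.ofReal_tsum_of_nonneg (fun z => by positivity)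
      ((lp.memℓp g).summable hpos)]
    exact ENNReal.ofReal_lt_top
  refine ⟨hmem.toLp, ?_⟩
  ext z : 2
  change (memLp_sigmaMk hq hmem.toLp z).toLp = g z
  rw [← Lp.toLp_coeFn (g z) (Lp.memLp _)]
  refine (MemLp.toLp_eq_toLp_iff _ _).2 ?_
  exact ae_of_ae_sigmaMeasure hmem.coeFn_toLp z

/-- The `ℓ^q`-sum of a family of `L^q` spaces is the `L^q` space of the disjoint union. -/
def lpSigmaEquiv (μ : ∀ z, Measure (Ω z)) (hq : q ≠ ∞) :
    Lp ℝ q (sigmaMeasure μ) ≃ₗᵢ[ℝ] lp (fun z => Lp ℝ q (μ z)) q :=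
  LinearIsometryEquiv.ofSurjective
    ⟨lpSigmaLinearMap μ hq, norm_lpSigmaLinearMap hq⟩ (lpSigmaLinearMap_surjective hq)

end SigmaMeasure

section Monomial

open scoped ENNReal

variable {Γ ι : Type*} [Group Γ] {Z : ι → Type*} [∀ i, MulAction Γ (Z i)]
  {E : ι → Type*} [∀ i, NormedAddCommGroup (E i)] [∀ i, NormedSpace ℝ (E i)]
  {q : ℝ≥0∞} [Fact (1 ≤ q)]

theorem hasSum_monomial (hq : q ≠ ∞) (c : ∀ i, Γ → Z i → (E i ≃ₗᵢ[ℝ] E i)) (γ : Γ)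
    (f : lp (fun z : Σ i, Z i => E z.1) q) :
    HasSum (fun z : Σ i, Z i => ‖c z.1 γ z.2 (f ⟨z.1, γ⁻¹ • z.2⟩)‖ ^ q.toReal)
      (‖f‖ ^ q.toReal) := by
  have hpos : 0 < q.toReal := ENNReal.toReal_pos (zero_lt_one.trans_le Fact.out).ne' hq
  have h := lp.hasSum_norm hpos f
  rw [← (Equiv.sigmaCongrRight fun i => MulAction.toPerm (α := Γ) (β := Z i) γ⁻¹).hasSum_iff] at h
  simp only [LinearIsometryEquiv.norm_map]
  exact h

/-- The isometry of a space of sections given by permuting fibres and twisting them. -/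
def monomialIsometry (hq : q ≠ ∞) (c : ∀ i, Γ → Z i → (E i ≃ₗᵢ[ℝ] E i)) (γ : Γ) :
    lp (fun z : Σ i, Z i => E z.1) q →ₗᵢ[ℝ] lp (fun z : Σ i, Z i => E z.1) q where
  toFun f := ⟨fun z => c z.1 γ z.2 (f ⟨z.1, γ⁻¹ • z.2⟩),
    memℓp_gen (hasSum_monomial hq c γ f).summable⟩
  map_add' f g := by
    ext z : 2
    exact map_add (c z.1 γ z.2) _ _
  map_smul' a f := by
    ext z : 2
    exact map_smul (c z.1 γ z.2) _ _
  norm_map' f := by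
    have hpos : 0 < q.toReal := ENNReal.toReal_pos (zero_lt_one.trans_le Fact.out).ne' hq
    refine (Real.rpow_left_inj (norm_nonneg _) (norm_nonneg _) hpos.ne').1 ?_
    exact (lp.hasSum_norm hpos _).unique (hasSum_monomial hq c γ f)

theorem monomialIsometry_apply (hq : q ≠ ∞) (c : ∀ i, Γ → Z i → (E i ≃ₗᵢ[ℝ] E i)) (γ : Γ)
    (f : lp (fun z : Σ i, Z i => E z.1) q) (z : Σ i, Z i) :
    monomialIsometry hq c γ f z = c z.1 γ z.2 (f ⟨z.1, γ⁻¹ • z.2⟩) := rfl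

theorem monomialIsometry_mul (hq : q ≠ ∞) (c : ∀ i, Γ → Z i → (E i ≃ₗᵢ[ℝ] E i))
    (hc : ∀ i γ γ' z, c i (γ * γ') z = c i γ z * c i γ' (γ⁻¹ • z)) (γ γ' : Γ)
    (f : lp (fun z : Σ i, Z i => E z.1) q) :
    monomialIsometry hq c (γ * γ') f = monomialIsometry hq c γ (monomialIsometry hq c γ' f) := by
  ext z : 2
  rw [monomialIsometry_apply, monomialIsometry_apply, monomialIsometry_apply, hc, mul_inv_rev,
    mul_smul]
  rfl

theorem monomialIsometry_one (hq : q ≠ ∞) (c : ∀ i, Γ → Z i → (E i ≃ₗᵢ[ℝ] E i))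
    (hc : ∀ i γ γ' z, c i (γ * γ') z = c i γ z * c i γ' (γ⁻¹ • z))
    (f : lp (fun z : Σ i, Z i => E z.1) q) :
    monomialIsometry hq c 1 f = f :=
  (monomialIsometry hq c 1).injective (by rw [← monomialIsometry_mul hq c hc, one_mul])

/-- The monomial representation attached to a family of fibre cocycles. -/
def monomialRep (hq : q ≠ ∞) (c : ∀ i, Γ → Z i → (E i ≃ₗᵢ[ℝ] E i))
    (hc : ∀ i γ γ' z, c i (γ * γ') z = c i γ z * c i γ' (γ⁻¹ • z)) :
    Γ →* (lp (fun z : Σ i, Z i => E z.1) q ≃ₗᵢ[ℝ] lp (fun z : Σ i, Z i => E z.1) q) :=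
  MonoidHom.mk'
    (fun γ => LinearIsometryEquiv.ofSurjective (monomialIsometry hq c γ) fun f =>
      ⟨monomialIsometry hq c γ⁻¹ f, by
        rw [← monomialIsometry_mul hq c hc, mul_inv_cancel, monomialIsometry_one hq c hc]⟩)
    fun γ γ' => LinearIsometryEquiv.ext fun f => monomialIsometry_mul hq c hc γ γ' f

theorem monomialRep_apply (hq : q ≠ ∞) (c : ∀ i, Γ → Z i → (E i ≃ₗᵢ[ℝ] E i))
    (hc : ∀ i γ γ' z, c i (γ * γ') z = c i γ z * c i γ' (γ⁻¹ • z)) (γ : Γ)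
    (f : lp (fun z : Σ i, Z i => E z.1) q) (i : ι) (z : Z i) :
    monomialRep hq c hc γ f ⟨i, z⟩ = c i γ z (f ⟨i, γ⁻¹ • z⟩) := rfl

theorem monomialRep_single [DecidableEq (Σ i, Z i)] (hq : q ≠ ∞)
    (c : ∀ i, Γ → Z i → (E i ≃ₗᵢ[ℝ] E i))
    (hc : ∀ i γ γ' z, c i (γ * γ') z = c i γ z * c i γ' (γ⁻¹ • z)) (γ : Γ)
    (i : ι) (z : Z i) (a : E i) :
    monomialRep hq c hc γ (lp.single (E := fun z : Σ i, Z i => E z.1) q ⟨i, z⟩ a)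
      = lp.single q ⟨i, γ • z⟩ (c i γ (γ • z) a) := by
  ext ⟨j, y⟩ : 2
  rw [monomialRep_apply]
  by_cases h : (⟨j, y⟩ : Σ i, Z i) = ⟨i, γ • z⟩
  · obtain ⟨rfl, h⟩ := Sigma.mk.inj h
    obtain rfl := eq_of_heq h
    rw [lp.single_apply_self, inv_smul_smul, lp.single_apply_self]
  · rw [lp.single_apply_ne _ _ _ h, lp.single_apply_ne, map_zero]
    contrapose h
    obtain ⟨rfl, h⟩ := Sigma.mk.inj h
    rw [← eq_of_heq h, smul_inv_smul]

/-- The twisting cocycle of an induced representation. -/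
theorem exists_induced_cocycle {A : Type*} [Group A] (K : Subgroup Γ) (π : K →* A) :
    ∃ c : Γ → Γ ⧸ K → A, (∀ γ γ' z, c (γ * γ') z = c γ z * c γ' (γ⁻¹ • z)) ∧
      ∀ k : K, c k ((1 : Γ) : Γ ⧸ K) = π k := by
  classical
  let σ : Γ ⧸ K → Γ := fun z => if z = ((1 : Γ) : Γ ⧸ K) then 1 else z.out
  have hσ (z : Γ ⧸ K) : (σ z : Γ ⧸ K) = z := by
    by_cases h : z = ((1 : Γ) : Γ ⧸ K) <;> simp [σ, h]
  have hσ1 : σ ((1 : Γ) : Γ ⧸ K) = 1 := if_pos rfl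
  have hmem (γ : Γ) (z : Γ ⧸ K) : (σ z)⁻¹ * (γ * σ (γ⁻¹ • z)) ∈ K := by
    rw [← QuotientGroup.eq, hσ, ← smul_eq_mul, ← MulAction.Quotient.smul_coe, hσ, smul_inv_smul]
  refine ⟨fun γ z => π ⟨_, hmem γ z⟩, fun γ γ' z => ?_, fun k => ?_⟩
  · rw [← map_mul]
    refine congrArg π (Subtype.ext ?_)
    simp [mul_smul, mul_assoc]
  · refine congrArg π (Subtype.ext ?_)
    have h : (k : Γ)⁻¹ • ((1 : Γ) : Γ ⧸ K) = ((1 : Γ) : Γ ⧸ K) := by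
      rw [MulAction.Quotient.smul_coe, QuotientGroup.eq]
      simp
    simp [h, hσ1]

end Monomial

section Affine

open scoped ENNReal

variable {G : Type} [Group G]

theorem exists_conj_cocycle {G : Type*} [Group G] {V W : Type*} [NormedAddCommGroup V] [NormedSpace ℝ V]
    [NormedAddCommGroup W] [NormedSpace ℝ W] (e : W ≃ₗᵢ[ℝ] V) (π : G →* (V ≃ₗᵢ[ℝ] V)) (b : G → V)
    (hb : ∀ g h, b (g * h) = π g (b h) + b g) :
    ∃ (π' : G →* (W ≃ₗᵢ[ℝ] W)) (b' : G → W),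
      (∀ g h, b' (g * h) = π' g (b' h) + b' g) ∧ ∀ g, ‖b' g‖ = ‖b g‖ := by
  refine ⟨MonoidHom.mk' (fun g => (e.trans (π g)).trans e.symm) fun g h => ?_,
    fun g => e.symm (b g), fun g h => ?_, fun g => e.symm.norm_map _⟩
  · ext x
    simp
  · simp [hb]

/-- A proper affine isometric action on an `L^q` space whose cocycle vanishes exactly on `K`
and is bounded below off `K`. -/
def HasNormalizedAction (G : Type) [Group G] (K : Subgroup G) (q : ℝ≥0∞) [Fact (1 ≤ q)] : Prop :=
  ∃ (Ω : Type) (_ : MeasurableSpace Ω) (μ : Measure Ω)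
    (π : G →* ((Lp ℝ q μ) ≃ₗᵢ[ℝ] (Lp ℝ q μ))) (b : G → Lp ℝ q μ),
    (∀ g h : G, b (g * h) = π g (b h) + b g) ∧ (∀ k ∈ K, b k = 0) ∧ (∀ g ∉ K, 1 ≤ ‖b g‖) ∧
    (∀ R : ℝ, {g : G | ‖b g‖ ≤ R}.Finite)

theorem exists_cocycle_vanishing_on_finite {V : Type*} [NormedAddCommGroup V] [NormedSpace ℝ V]
    (π : G →* (V ≃ₗᵢ[ℝ] V)) (b : G → V) (hb : ∀ g h, b (g * h) = π g (b h) + b g)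
    (hfin : ∀ R : ℝ, {g : G | ‖b g‖ ≤ R}.Finite) (K : Subgroup G) [Finite K] :
    ∃ b' : G → V, (∀ g h, b' (g * h) = π g (b' h) + b' g) ∧ (∀ k ∈ K, b' k = 0) ∧
      ∀ R : ℝ, {g : G | ‖b' g‖ ≤ R}.Finite := by
  have := Fintype.ofFinite K
  let v : V := (Fintype.card K : ℝ)⁻¹ • ∑ k : K, b k
  have hcard : (Fintype.card K : ℝ) ≠ 0 := Nat.cast_ne_zero.2 Fintype.card_ne_zero
  have hv (k : K) : π k v = v - b k := by
    have h1 : ∑ x : K, b ((k : G) * x) = ∑ x : K, b x :=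
      Fintype.sum_equiv (Equiv.mulLeft k) _ _ fun x => rfl
    have h2 : ∑ x : K, π (k : G) (b x) = ∑ x : K, b x - (Fintype.card K : ℝ) • b k := by
      rw [← h1, eq_sub_iff_add_eq, Nat.cast_smul_eq_nsmul, ← Finset.card_univ, ← Finset.sum_const,
        ← Finset.sum_add_distrib]
      exact Finset.sum_congr rfl fun x _ => (hb _ _).symm
    simp only [v]
    rw [map_smul, map_sum, h2, smul_sub, inv_smul_smul₀ hcard]
  refine ⟨fun g => b g + π g v - v, fun g h => ?_, fun k hk => ?_, fun R => ?_⟩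
  · simp only [hb, map_mul, LinearIsometryEquiv.coe_mul, Function.comp_apply, map_add, map_sub]
    abel
  · simp [hv ⟨k, hk⟩]
  · refine (hfin (R + 2 * ‖v‖)).subset fun g hg => ?_
    have h1 : b g = (b g + π g v - v) - π g v + v := by abel
    have h2 := norm_add_le ((b g + π g v - v) - π g v) v
    have h3 := norm_sub_le (b g + π g v - v) (π g v)
    rw [LinearIsometryEquiv.norm_map] at h3
    rw [← h1] at h2
    simp only [Set.mem_ofPred_eq] at hg ⊢
    linarith

theorem exists_unit_vector_action {q : ℝ≥0∞} [Fact (1 ≤ q)] (hq : q ≠ ∞)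
    {Ω : Type} [MeasurableSpace Ω] {μ : Measure Ω}
    (π : G →* ((Lp ℝ q μ) ≃ₗᵢ[ℝ] (Lp ℝ q μ))) (b : G → Lp ℝ q μ)
    (hb : ∀ g h : G, b (g * h) = π g (b h) + b g) (hfin : ∀ R : ℝ, {g : G | ‖b g‖ ≤ R}.Finite) :
    ∃ (Ω : Type) (_ : MeasurableSpace Ω) (μ : Measure Ω)
      (π : G →* ((Lp ℝ q μ) ≃ₗᵢ[ℝ] (Lp ℝ q μ))) (b : G → Lp ℝ q μ) (u : Lp ℝ q μ),
      (∀ g h : G, b (g * h) = π g (b h) + b g) ∧ (∀ R : ℝ, {g : G | ‖b g‖ ≤ R}.Finite) ∧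
      ‖u‖ = 1 := by
  rcases subsingleton_or_nontrivial (Lp ℝ q μ) with h | h
  · have hG : (Set.univ : Set G).Finite := (hfin 0).subset fun g _ => by
      simp [Subsingleton.elim (b g) 0]
    refine ⟨Unit, inferInstance, Measure.dirac (), 1, 0,
      indicatorConstLp q MeasurableSet.univ (by simp) 1, by simp,
      fun R => hG.subset (Set.subset_univ _), ?_⟩
    rw [norm_indicatorConstLp (zero_lt_one.trans_le Fact.out).ne' hq]
    simp
  · obtain ⟨u, hu⟩ := exists_norm_eq (Lp ℝ q μ) zero_le_one
    exact ⟨Ω, _, μ, π, b, u, hb, hfin, hu⟩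

theorem HasPLpDiscrete.hasNormalizedAction {p : ℝ} [Fact (1 ≤ ENNReal.ofReal p)]
    (h : HasPLpDiscrete G p) (K : Subgroup G) [Finite K] :
    HasNormalizedAction G K (ENNReal.ofReal p) := by
  classical
  have hq : ENNReal.ofReal p ≠ ∞ := ENNReal.ofReal_ne_top
  have hq0 : 0 < ENNReal.ofReal p := zero_lt_one.trans_le Fact.out
  obtain ⟨_, _, _, _, π₀, b₀, hb₀, hfin₀⟩ := h
  obtain ⟨Ω, _, μ, π, b₁, u, hb₁, hfin₁, hu⟩ := exists_unit_vector_action hq π₀ b₀ hb₀ hfin₀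
  obtain ⟨b, hb, hbK, hfin⟩ := exists_cocycle_vanishing_on_finite π b₁ hb₁ hfin₁ K
  let c : ∀ _ : Unit, G → Option (G ⧸ K) → (Lp ℝ (ENNReal.ofReal p) μ ≃ₗᵢ[ℝ] _) :=
    fun _ g z => z.elim (π g) fun _ => 1
  have hc : ∀ i g h z, c i (g * h) z = c i g z * c i h (g⁻¹ • z) := by
    rintro - g h (_ | z)
    · exact map_mul π g h
    · exact (one_mul _).symm
  let ρ := monomialRep hq c hc
  let S (z : Option (G ⧸ K)) (a : Lp ℝ (ENNReal.ofReal p) μ) :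
      lp (fun _ : Σ _ : Unit, Option (G ⧸ K) => Lp ℝ (ENNReal.ofReal p) μ) (ENNReal.ofReal p) :=
    lp.single _ ⟨(), z⟩ a
  have hρ_none (g : G) (a) : ρ g (S none a) = S none (π g a) :=
    monomialRep_single hq c hc g () none a
  have hρ_some (g h : G) (a) : ρ g (S (some (h : G ⧸ K)) a) = S (some ((g * h : G) : G ⧸ K)) a :=
    monomialRep_single hq c hc g () (some (h : G ⧸ K)) a
  let B (g : G) := S none (b g) + (S (some (g : G ⧸ K)) u - S (some ((1 : G) : G ⧸ K)) u)
  have hB (g h : G) : B (g * h) = ρ g (B h) + B g := by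
    simp only [B, map_add, map_sub, hρ_none, hρ_some, hb, mul_one]
    have : S none (π g (b h) + b g) = S none (π g (b h)) + S none (b g) := lp.single_add ..
    rw [this]
    abel
  have hB_none (g : G) : B g ⟨(), none⟩ = b g := by
    simp [B, S, lp.single_apply]
  have hB_some (g : G) (hg : g ∉ K) : B g ⟨(), some (g : G ⧸ K)⟩ = u := by
    have : ¬ (g : G ⧸ K) = ((1 : G) : G ⧸ K) := by
      rwa [eq_comm, QuotientGroup.eq, inv_one, one_mul]
    simp [B, S, lp.single_apply, this]
  obtain ⟨π', b', hb', hnorm⟩ :=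
    exists_conj_cocycle (lpSigmaEquiv (fun _ : Σ _ : Unit, Option (G ⧸ K) => μ) hq) ρ B hB
  refine ⟨_, _, _, π', b', hb', fun k hk => ?_, fun g hg => ?_, fun R => ?_⟩
  · have h1 : (k : G ⧸ K) = ((1 : G) : G ⧸ K) := by
      rw [eq_comm, QuotientGroup.eq, inv_one, one_mul]
      exact hk
    have h0 : S none 0 = 0 := lp.single_zero ..
    rw [← norm_eq_zero, hnorm]
    simp [B, hbK k hk, h1, h0]
  · rw [hnorm, ← hu, ← hB_some g hg]
    exact lp.norm_apply_le_norm hq0.ne' _ _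
  · refine (hfin R).subset fun g hg => ?_
    have := lp.norm_apply_le_norm hq0.ne' (B g) ⟨(), none⟩
    rw [hB_none, ← hnorm] at this
    exact this.trans hg

end Affine

section Pushout

open scoped ENNReal
open Monoid

variable {ι : Type} {A : ι → Type} [∀ i, Group (A i)] {F : Type} [Group F] {φ : ∀ i, F →* A i}

/-- The product in the amalgamated product of a list of letters. -/
def syllableProd (φ : ∀ i, F →* A i) (l : List (Σ i, A i)) : PushoutI φ :=
  (l.map fun x => PushoutI.of x.1 x.2).prod

theorem syllableProd_nil : syllableProd φ [] = 1 := rfl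

theorem syllableProd_cons (x : Σ i, A i) (l : List (Σ i, A i)) :
    syllableProd φ (x :: l) = PushoutI.of x.1 x.2 * syllableProd φ l :=
  List.prod_cons

theorem syllableProd_append (l l' : List (Σ i, A i)) :
    syllableProd φ (l ++ l') = syllableProd φ l * syllableProd φ l' := by
  simp [syllableProd]

/-- Lists of letters outside the amalgamated subgroup, adjacent ones from distinct factors. -/
def IsReducedList (φ : ∀ i, F →* A i) (l : List (Σ i, A i)) : Prop :=
  l.IsChain (fun x y => x.1 ≠ y.1) ∧ ∀ x ∈ l, x.2 ∉ (φ x.1).range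

theorem ofCoprodI_prod (w : CoprodI.Word A) :
    PushoutI.ofCoprodI w.prod = syllableProd φ w.toList := by
  simp [CoprodI.Word.prod, syllableProd, map_list_prod, Function.comp_def]

theorem IsReducedList.eq_nil_of_mem_base_range (hφ : ∀ i, Function.Injective (φ i))
    {l : List (Σ i, A i)} (hl : IsReducedList φ l)
    (h : syllableProd φ l ∈ (PushoutI.base φ).range) : l = [] := by
  let w : CoprodI.Word A := ⟨l, fun x hx h1 => hl.2 x hx (h1 ▸ one_mem _), hl.1⟩
  have hw : PushoutI.Reduced φ w := hl.2
  have := hw.eq_empty_of_mem_range hφ (by rwa [ofCoprodI_prod])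
  exact congrArg CoprodI.Word.toList this

theorem IsReducedList.eq_nil_of_mem_of_range (hφ : ∀ i, Function.Injective (φ i))
    {l : List (Σ i, A i)} (hl : IsReducedList φ l) {i : ι} (hi : ∀ x ∈ l.head?, i ≠ x.1)
    (h : syllableProd φ l ∈ (PushoutI.of (φ := φ) i).range) : l = [] := by
  obtain ⟨g, hg⟩ := h
  by_cases hgF : g ∈ (φ i).range
  · obtain ⟨f, rfl⟩ := hgF
    exact hl.eq_nil_of_mem_base_range hφ ⟨f, by rw [← hg, PushoutI.of_apply_eq_base]⟩
  · have hred : IsReducedList φ (⟨i, g⁻¹⟩ :: l) := by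
      refine ⟨List.isChain_cons.2 ⟨hi, hl.1⟩, ?_⟩
      rintro x (_ | ⟨_, hx⟩)
      · rwa [inv_mem_iff]
      · exact hl.2 x hx
    have h1 : syllableProd φ (⟨i, g⁻¹⟩ :: l) = 1 := by
      rw [syllableProd_cons, ← hg, map_inv, inv_mul_cancel]
    exact absurd (hred.eq_nil_of_mem_base_range hφ (h1 ▸ one_mem _)) (List.cons_ne_nil _ _)

theorem exists_eq_base_mul_syllableProd (hφ : ∀ i, Function.Injective (φ i)) (γ : PushoutI φ) :
    ∃ (f : F) (l : List (Σ i, A i)),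
      IsReducedList φ l ∧ γ = PushoutI.base φ f * syllableProd φ l := by
  classical
  obtain ⟨d⟩ := PushoutI.NormalWord.transversal_nonempty φ hφ
  let w : PushoutI.NormalWord d := PushoutI.NormalWord.equiv γ
  have hw : w.prod = γ := PushoutI.NormalWord.equiv.symm_apply_apply γ
  refine ⟨w.head, w.toList, ⟨w.chain_ne, ?_⟩, ?_⟩
  · rintro ⟨i, g⟩ hx hg
    refine w.ne_one _ hx ?_
    have h1 := (d.compl i).1 (a₁ := (⟨g, hg⟩, ⟨1, d.one_mem i⟩))
      (a₂ := (1, ⟨g, w.normalized i g hx⟩)) (by simp)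
    exact (congrArg (fun y => ((y.2 : d.set i) : A i)) h1).symm
  · rw [← hw, PushoutI.NormalWord.prod, ofCoprodI_prod]

/-- A cocycle on the amalgamated product glued from cocycles on the factors that vanish on the
amalgamated subgroup. -/
theorem exists_glued_cocycle {V : Type*} [NormedAddCommGroup V] [NormedSpace ℝ V]
    (ρ : PushoutI φ →* (V ≃ₗᵢ[ℝ] V)) (B : ∀ i, A i → V)
    (hB : ∀ i g h, B i (g * h) = ρ (PushoutI.of i g) (B i h) + B i g)
    (hB0 : ∀ i f, B i (φ i f) = 0) :
    ∃ b : PushoutI φ → V, (∀ γ γ', b (γ * γ') = ρ γ (b γ') + b γ) ∧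
      (∀ i g, b (PushoutI.of i g) = B i g) ∧ ∀ f, b (PushoutI.base φ f) = 0 := by
  let T (γ : PushoutI φ) (v : V) : Equiv.Perm V := (ρ γ).toEquiv.trans (Equiv.addRight v)
  have hT (γ v x) : T γ v x = ρ γ x + v := rfl
  let α : PushoutI φ →* Equiv.Perm V := PushoutI.lift
    (fun i => MonoidHom.mk' (fun g => T (PushoutI.of i g) (B i g)) fun g h => by
      ext x
      simp [hT, hB, add_assoc])
    (MonoidHom.mk' (fun f => T (PushoutI.base φ f) 0) fun f f' => by
      ext x
      simp [hT])
    (fun i => by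
      ext f x
      simp [hT, hB0, PushoutI.of_apply_eq_base])
  have hα_of (i g x) : α (PushoutI.of i g) x = ρ (PushoutI.of i g) x + B i g := by
    simp [α, PushoutI.lift_of, hT]
  have hα_base (f x) : α (PushoutI.base φ f) x = ρ (PushoutI.base φ f) x := by
    simp [α, PushoutI.lift_base, hT]
  have hα (γ) : ∀ x, α γ x = ρ γ x + α γ 0 := by
    induction γ using PushoutI.induction_on with
    | of i g => intro x; simp [hα_of]
    | base f => intro x; simp [hα_base]
    | mul γ γ' h h' =>
      intro x
      rw [map_mul, map_mul, Equiv.Perm.mul_apply, Equiv.Perm.mul_apply, h, h' x, h (α γ' 0),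
        map_add, add_assoc]
      rfl
  refine ⟨fun γ => α γ 0, fun γ γ' => ?_, fun i g => ?_, fun f => ?_⟩
  · beta_reduce
    rw [map_mul, Equiv.Perm.mul_apply, hα γ]
  · simp [hα_of]
  · simp [hα_base]

theorem Set.Finite.prod_of_length_le {M : Type*} [Monoid M] {T : Set M} (hT : T.Finite) (N : ℕ) :
    {m | ∃ l : List M, l.length ≤ N ∧ (∀ x ∈ l, x ∈ T) ∧ l.prod = m}.Finite := by
  induction N with
  | zero =>
    refine (Set.finite_singleton 1).subset ?_
    rintro _ ⟨l, hl, -, rfl⟩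
    simp [List.length_eq_zero_iff.1 (Nat.le_zero.1 hl)]
  | succ N ih =>
    refine ((hT.image2 (· * ·) ih).insert 1).subset ?_
    rintro _ ⟨_ | ⟨x, l⟩, hl, hlT, rfl⟩
    · exact Or.inl rfl
    · refine Or.inr ⟨x, hlT x List.mem_cons_self, l.prod, ⟨l, Nat.le_of_succ_le_succ hl,
        fun y hy => hlT y (List.mem_cons_of_mem _ hy), rfl⟩, List.prod_cons.symm⟩

section InducedNorm

variable {E : ι → Type*} [∀ i, NormedAddCommGroup (E i)] [∀ i, NormedSpace ℝ (E i)]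
  {q : ℝ≥0∞} [Fact (1 ≤ q)]

/-- The `ℓ^q`-sum of copies of the spaces `E i` over the vertices of the Bass–Serre tree. -/
abbrev TreeSum (φ : ∀ i, F →* A i) (E : ι → Type*) [∀ i, NormedAddCommGroup (E i)] (q : ℝ≥0∞) :=
  lp (fun z : Σ i, PushoutI φ ⧸ (PushoutI.of (φ := φ) i).range => E z.1) q

variable (hφ : ∀ i, Function.Injective (φ i)) (hq : q ≠ ∞)
  {c : ∀ i, PushoutI φ → PushoutI φ ⧸ (PushoutI.of (φ := φ) i).range → (E i ≃ₗᵢ[ℝ] E i)}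
  (hc : ∀ i γ γ' z, c i (γ * γ') z = c i γ z * c i γ' (γ⁻¹ • z))
  {b : PushoutI φ → TreeSum φ E q} (hb : ∀ γ γ', b (γ * γ') = monomialRep hq c hc γ (b γ') + b γ)
  {β : ∀ i, A i → E i}
  (hsupp : ∀ i g z, z ≠ ⟨i, ((1 : PushoutI φ) : _ ⧸ _)⟩ → b (PushoutI.of i g) z = 0)
  (hbβ : ∀ i g, b (PushoutI.of i g) ⟨i, ((1 : PushoutI φ) : _ ⧸ _)⟩ = β i g)

include hφ hb hsupp in
theorem apply_syllableProd_eq_zero {i : ι} (l : List (Σ i, A i)) :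
    ∀ u : List (Σ i, A i), IsReducedList φ (u ++ l) → (∀ x ∈ (u ++ l).head?, i ≠ x.1) →
      b (syllableProd φ l)
        ⟨i, (((syllableProd φ u)⁻¹ : PushoutI φ) : PushoutI φ ⧸ (PushoutI.of (φ := φ) i).range)⟩
        = 0 := by
  have hb1 : b 1 = 0 := by simpa using hb 1 1
  induction l with
  | nil => intro u _ _; rw [syllableProd_nil, hb1]; rfl
  | cons x l ih =>
    intro u hu hi
    have h1 := ih (u ++ [x]) (by simpa using hu) (by simpa using hi)
    rw [syllableProd_cons, hb, lp.coeFn_add, Pi.add_apply, monomialRep_apply,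
      MulAction.Quotient.smul_coe, smul_eq_mul, ← mul_inv_rev]
    rw [syllableProd_append, syllableProd_cons, syllableProd_nil, mul_one] at h1
    rw [h1, map_zero, zero_add]
    refine hsupp _ _ _ fun h => ?_
    obtain ⟨rfl, h⟩ := Sigma.mk.inj h
    have h2 := eq_of_heq h
    rw [QuotientGroup.eq, inv_inv, mul_one] at h2
    have h3 : IsReducedList φ u :=
      ⟨hu.1.left_of_append, fun y hy => hu.2 y (List.mem_append_left _ hy)⟩
    cases u with
    | nil => exact hi x rfl rfl
    | cons y u =>
      exact List.cons_ne_nil _ _ (h3.eq_nil_of_mem_of_range hφ (by simpa using hi) h2)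

include hφ hb hsupp hbβ in
theorem norm_syllableProd_rpow {l : List (Σ i, A i)} (hl : IsReducedList φ l) :
    ‖b (syllableProd φ l)‖ ^ q.toReal = (l.map fun x => ‖β x.1 x.2‖ ^ q.toReal).sum := by
  classical
  have hpos : 0 < q.toReal := ENNReal.toReal_pos (zero_lt_one.trans_le Fact.out).ne' hq
  have hb1 : b 1 = 0 := by simpa using hb 1 1
  induction l with
  | nil => simp [syllableProd_nil, hb1, hpos.ne']
  | cons x l ih =>
    obtain ⟨hx, hl'⟩ := List.isChain_cons.1 hl.1
    have hred : IsReducedList φ l := ⟨hl', fun y hy => hl.2 y (List.mem_cons_of_mem _ hy)⟩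
    have h0 := apply_syllableProd_eq_zero hφ hq hc hb hsupp l [] hred hx
    rw [syllableProd_nil, inv_one] at h0
    let v : Σ i, PushoutI φ ⧸ (PushoutI.of (φ := φ) i).range := ⟨x.1, ((1 : PushoutI φ) : _ ⧸ _)⟩
    let r := monomialRep hq c hc (PushoutI.of x.1 x.2) (b (syllableProd φ l))
    have hr0 : r v = 0 := by
      have : (PushoutI.of (φ := φ) x.1 x.2)⁻¹ • ((1 : PushoutI φ) : PushoutI φ ⧸
          (PushoutI.of (φ := φ) x.1).range) = ((1 : PushoutI φ) : _ ⧸ _) := by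
        rw [MulAction.Quotient.smul_coe, QuotientGroup.eq]
        simp
      rw [monomialRep_apply, this, h0, map_zero]
    have hsingle : b (PushoutI.of x.1 x.2) = lp.single q v (β x.1 x.2) := by
      ext z : 2
      by_cases hz : z = v
      · rw [hz, lp.single_apply_self, hbβ]
      · rw [lp.single_apply_ne _ _ _ hz, hsupp _ _ _ hz]
    have hsum : b (syllableProd φ (x :: l)) = r + lp.single q v (β x.1 x.2) := by
      rw [syllableProd_cons, hb, hsingle]
    have hv : b (syllableProd φ (x :: l)) v = β x.1 x.2 := by
      rw [hsum, lp.coeFn_add, Pi.add_apply, hr0, zero_add, lp.single_apply_self]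
    have key := lp.norm_sub_norm_compl_sub_single hpos (b (syllableProd φ (x :: l))) {v}
    rw [Finset.sum_singleton, Finset.sum_singleton, hv, hsum, add_sub_cancel_right, ← hsum,
      LinearIsometryEquiv.norm_map, ih hred] at key
    rw [List.map_cons, List.sum_cons]
    linarith

include hφ hb hsupp hbβ in
theorem finite_norm_le [Finite ι] [Finite F] (hb0 : ∀ f, b (PushoutI.base φ f) = 0)
    (hβ1 : ∀ i, ∀ g ∉ (φ i).range, 1 ≤ ‖β i g‖) (hβfin : ∀ i (R : ℝ), {g | ‖β i g‖ ≤ R}.Finite)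
    (R : ℝ) : {γ | ‖b γ‖ ≤ R}.Finite := by
  have hpos : 0 < q.toReal := ENNReal.toReal_pos (zero_lt_one.trans_le Fact.out).ne' hq
  let T : Set (PushoutI φ) := ⋃ i, PushoutI.of i '' {g | ‖β i g‖ ≤ R}
  have hT : T.Finite := Set.finite_iUnion fun i => (hβfin i R).image _
  let N : ℕ := ⌊R ^ q.toReal⌋₊
  refine (Set.Finite.image2 (· * ·) (Set.finite_range (PushoutI.base φ))
    (hT.prod_of_length_le N)).subset fun γ hγ => ?_
  obtain ⟨f, l, hl, rfl⟩ := exists_eq_base_mul_syllableProd hφ γ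
  refine ⟨_, ⟨f, rfl⟩, _, ?_, rfl⟩
  rw [Set.mem_ofPred_eq, hb, hb0, add_zero, LinearIsometryEquiv.norm_map] at hγ
  have hR : 0 ≤ R := (norm_nonneg _).trans hγ
  have hle : (l.map fun x => ‖β x.1 x.2‖ ^ q.toReal).sum ≤ R ^ q.toReal := by
    rw [← norm_syllableProd_rpow hφ hq hc hb hsupp hbβ hl]
    gcongr
  refine ⟨_, ?_, ?_, rfl⟩
  · rw [List.length_map]
    refine Nat.le_floor (le_trans ?_ hle)
    have := List.card_nsmul_le_sum (l.map fun x => ‖β x.1 x.2‖ ^ q.toReal) 1 (by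
      simp only [List.mem_map]
      rintro _ ⟨x, hx, rfl⟩
      exact Real.one_le_rpow (hβ1 _ _ (hl.2 x hx)) hpos.le)
    simpa using this
  · simp only [List.mem_map]
    rintro _ ⟨x, hx, rfl⟩
    refine Set.mem_iUnion.2 ⟨x.1, x.2, ?_, rfl⟩
    have : ‖β x.1 x.2‖ ^ q.toReal ≤ (l.map fun x => ‖β x.1 x.2‖ ^ q.toReal).sum :=
      List.single_le_sum (by simp only [List.mem_map]; rintro _ ⟨x, -, rfl⟩; positivity) _
        (List.mem_map.2 ⟨x, hx, rfl⟩)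
    exact (Real.rpow_le_rpow_iff (norm_nonneg _) hR hpos).1 (this.trans hle)

end InducedNorm

theorem hasPLpDiscrete_pushoutI [Finite ι] [Finite F] (hφ : ∀ i, Function.Injective (φ i)) {p : ℝ}
    [hp : Fact (1 ≤ ENNReal.ofReal p)]
    (h : ∀ i, HasNormalizedAction (A i) (φ i).range (ENNReal.ofReal p)) :
    HasPLpDiscrete (PushoutI φ) p := by
  classical
  have hq : ENNReal.ofReal p ≠ ∞ := ENNReal.ofReal_ne_top
  choose Ω mΩ μ π β hβ hβ0 hβ1 hβfin using h
  let e (i : ι) := MonoidHom.ofInjective (PushoutI.of_injective hφ i)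
  choose c hc hc1 using fun i => exists_induced_cocycle (PushoutI.of (φ := φ) i).range
    ((π i).comp (e i).symm.toMonoidHom)
  have hc1' (i : ι) (g : A i) : c i (PushoutI.of i g) ((1 : PushoutI φ) : _ ⧸ _) = π i g :=
    (hc1 i (e i g)).trans (congrArg (π i) ((e i).symm_apply_apply g))
  have hfix (i : ι) (g : A i) : PushoutI.of (φ := φ) i g • ((1 : PushoutI φ) : PushoutI φ ⧸
      (PushoutI.of (φ := φ) i).range) = ((1 : PushoutI φ) : _ ⧸ _) := by
    rw [MulAction.Quotient.smul_coe, QuotientGroup.eq]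
    simp
  let B (i : ι) (g : A i) :
      TreeSum φ (fun i => Lp ℝ (ENNReal.ofReal p) (μ i)) (ENNReal.ofReal p) :=
    lp.single _ ⟨i, ((1 : PushoutI φ) : _ ⧸ _)⟩ (β i g)
  have hB (i : ι) (g h : A i) :
      B i (g * h) = monomialRep hq c hc (PushoutI.of i g) (B i h) + B i g := by
    simp only [B]
    rw [monomialRep_single, hfix, hc1', hβ]
    exact lp.single_add ..
  have hB0 (i : ι) (f : F) : B i (φ i f) = 0 := by
    simp only [B]
    rw [hβ0 i _ ⟨f, rfl⟩]
    exact lp.single_zero ..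
  obtain ⟨b, hb, hb_of, hb_base⟩ := exists_glued_cocycle (monomialRep hq c hc) B hB hB0
  have hfin := finite_norm_le hφ hq hc hb (β := β)
    (fun i g z hz => by rw [hb_of]; exact lp.single_apply_ne _ _ _ hz)
    (fun i g => by rw [hb_of]; exact lp.single_apply_self ..) hb_base hβ1 hβfin
  obtain ⟨π', b', hb', hnorm⟩ := exists_conj_cocycle (lpSigmaEquiv
    (fun z : Σ i, PushoutI φ ⧸ (PushoutI.of (φ := φ) i).range => μ z.1) hq) _ b hb
  exact ⟨_, _, _, hp, π', b', hb', fun R => by simpa only [hnorm] using hfin R⟩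

end Pushout

theorem HasPLpDiscrete.of_injective {G H : Type*} [Group G] [Group H] {p : ℝ}
    (h : HasPLpDiscrete H p) (f : G →* H) (hf : Function.Injective f) : HasPLpDiscrete G p := by
  obtain ⟨Ω, _, μ, hp, π, b, hb, hfin⟩ := h
  exact ⟨Ω, _, μ, hp, π.comp f, b ∘ f, fun g h => by simp [hb],
    fun R => (hfin R).preimage hf.injOn⟩

/-- Let `G, H` be countable discrete groups, `F` a finite group with
injections `F ↪ G`, `F ↪ H`, and `p > 1` with `p ∉ 2ℤ ∖ {2}`. Then `G` and `H` have
property `PL^p` if and only if `G *_F H` has property `PL^p`. -/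
theorem statement11 (p : ℝ) (hp : 1 < p) (hp2 : ∀ n : ℤ, p = 2 * (n : ℝ) → p = 2)
    (G H F : Type) [Group G] [Group H] [Group F]
    [Countable G] [Countable H] [Finite F]
    (φG : F →* G) (φH : F →* H)
    (hinjG : Function.Injective φG) (hinjH : Function.Injective φH) :
    (HasPLpDiscrete G p ∧ HasPLpDiscrete H p) ↔
      HasPLpDiscrete (AmalgamatedFreeProduct φG φH) p := by
  have hinj : ∀ i, Function.Injective (amalgMaps φG φH i) := by
    rintro (_ | _)
    exacts [hinjH, hinjG]
  constructor
  · rintro ⟨hG, hH⟩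
    have : Fact (1 ≤ ENNReal.ofReal p) := ⟨ENNReal.one_le_ofReal.2 hp.le⟩
    refine hasPLpDiscrete_pushoutI hinj ?_
    rintro (_ | _)
    · have : Finite (amalgMaps φG φH false).range := Set.finite_range φH
      exact @HasPLpDiscrete.hasNormalizedAction H _ p _ hH (amalgMaps φG φH false).range this
    · have : Finite (amalgMaps φG φH true).range := Set.finite_range φG
      exact @HasPLpDiscrete.hasNormalizedAction G _ p _ hG (amalgMaps φG φH true).range this
  · intro h
    exact ⟨h.of_injective (G := G) (Monoid.PushoutI.of (φ := amalgMaps φG φH) true)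
        (Monoid.PushoutI.of_injective hinj true),
      h.of_injective (G := H) (Monoid.PushoutI.of (φ := amalgMaps φG φH) false)
        (Monoid.PushoutI.of_injective hinj false)⟩

end
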